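/- If α is a real constant with 0 < α < 1, then lim_{n→∞} |Λ_n(⌊αn⌋)| / n! ≤ lim_{n→∞} |Λ_n(⌊n/2⌋)| / n! = 1/2. -/

import Mathlib

open Finset

namespace Secretary

/-- Relative rank of `x` with regard to `P`: the number of `z ∈ P` with `z ≤ x`
(as an integer, so that differences can be computed in `ℤ`). -/
def rr {n : ℕ} (P : Finset (Fin n)) (x : Fin n) : ℤ :=
  ((P.filter fun z => z ≤ x).card : ℤ)

/-- `Δ(k) = {-1, 1, k-1, 1-k} ⊆ ℤ`. -/
def Δ (k : ℕ) : Finset ℤ := {-1, 1, (k : ℤ) - 1, 1 - (k : ℤ)}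

/-- `{x, y} ∈ Adj(P)`: both belong to `P` and the difference of their relative
ranks with regard to `P` (in one of the two orders) lies in `Δ(|P|)`. -/
def Adj {n : ℕ} (P : Finset (Fin n)) (x y : Fin n) : Prop :=
  x ∈ P ∧ y ∈ P ∧ (rr P x - rr P y ∈ Δ P.card ∨ rr P y - rr P x ∈ Δ P.card)

instance {n : ℕ} (P : Finset (Fin n)) (x y : Fin n) : Decidable (Adj P x y) := by
  unfold Adj; infer_instance

/-- `Ω n`: the sequences of `n` distinct applicants (as injective, hence
bijective, functions `Fin n → Fin n`); `|Ω n| = n!`. -/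
def Ω (n : ℕ) : Finset (Fin n → Fin n) :=
  Finset.univ.filter Function.Injective

/-- The `i`-th applicant of the sequence `x`, with the 1-based indexing
`x_1, …, x_n` of the paper. -/
def get {n : ℕ} [NeZero n] (x : Fin n → Fin n) (i : ℕ) : Fin n :=
  x ⟨(i - 1) % n, Nat.mod_lt _ (Nat.pos_of_ne_zero (NeZero.ne n))⟩

/-- The set `{x_1, …, x_i}` of the first `i` applicants of the sequence `x`. -/
def pre {n : ℕ} (x : Fin n → Fin n) (i : ℕ) : Finset (Fin n) :=
  (Finset.univ.filter fun j : Fin n => (j : ℕ) < i).image x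

/-- `Λ_n(r,k)`: sequences `x ∈ Ω_n` with `{x_k, x_{k+1}} ∈ Adj(C_n)` and
`{x_{i-1}, x_i} ∉ Adj({x_1,…,x_i})` for all `i ∈ {r,…,k}`. -/
def Lam : (n : ℕ) → ℕ → ℕ → Finset (Fin n → Fin n)
  | 0, _, _ => ∅
  | (m + 1), r, k =>
      (Ω (m + 1)).filter fun x =>
        Adj Finset.univ (get x k) (get x (k + 1)) ∧
          ∀ i, i ≤ k → r ≤ i → ¬ Adj (pre x i) (get x (i - 1)) (get x i)

/-- `Λ_n(r) = ⋃_{k=r}^{n-1} Λ_n(r,k)`. -/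
def LamU (n : ℕ) (r : ℕ) : Finset (Fin n → Fin n) :=
  (Finset.Icc r (n - 1)).biUnion fun k => Lam n r k

/-- `Π_n(r)`: those `x ∈ Λ_n(r)` such that for the (unique) `k` with
`x ∈ Λ_n(r,k)` one has `rr_n(x_k) - rr_n(x_{k+1}) ∈ {1-n, n-1}`. -/
def Pi' : (n : ℕ) → ℕ → Finset (Fin n → Fin n)
  | 0, _ => ∅
  | (m + 1), r =>
      (LamU (m + 1) r).filter fun x =>
        ∃ k ∈ Finset.Icc r m, x ∈ Lam (m + 1) r k ∧
          rr Finset.univ (get x k) - rr Finset.univ (get x (k + 1)) ∈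
            ({1 - ((m : ℤ) + 1), ((m : ℤ) + 1) - 1} : Finset ℤ)

/-- `Λ_n(r,k,z,z̄)`: sequences of `Λ_n(r,k)` with `x_k = z` and `x_{k+1} = z̄`. -/
def Lam4 : (n : ℕ) → ℕ → ℕ → Fin n → Fin n → Finset (Fin n → Fin n)
  | 0, _, _, z, _ => z.elim0
  | (m + 1), r, k, z, w =>
      (Lam (m + 1) r k).filter fun x => get x k = z ∧ get x (k + 1) = w

theorem card_filter_mul_card_eq {X ι : Type*} (S : Finset X) (I : Finset ι)
    (σ : ι → X → X) (hinv : ∀ i ∈ I, ∀ y, σ i (σ i y) = y)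
    (hS : ∀ i ∈ I, ∀ y ∈ S, σ i y ∈ S) (R : X → Prop) [DecidablePred R] (c : ℕ)
    (h : ∀ y ∈ S, #{i ∈ I | R (σ i y)} = c) :
    #(S.filter R) * #I = #S * c := by
  have h1 : ∀ i ∈ I, #{y ∈ S | R (σ i y)} = #(S.filter R) := by
    intro i hi
    refine Finset.card_bij' (fun y _ => σ i y) (fun y _ => σ i y) ?_ ?_ ?_ ?_
    · intro y hy
      rw [mem_filter] at hy ⊢
      exact ⟨hS i hi y hy.1, hy.2⟩
    · intro y hy
      rw [mem_filter] at hy ⊢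
      exact ⟨hS i hi y hy.1, by rw [hinv i hi]; exact hy.2⟩
    · intro y _
      exact hinv i hi y
    · intro y _
      exact hinv i hi y
  have h2 : ∑ i ∈ I, #{y ∈ S | R (σ i y)} = ∑ y ∈ S, #{i ∈ I | R (σ i y)} :=
    Finset.sum_card_bipartiteAbove_eq_sum_card_bipartiteBelow (fun i y => R (σ i y))
  rw [Finset.sum_congr rfl h1, Finset.sum_congr rfl h, sum_const, sum_const] at h2
  simpa [mul_comm] using h2

theorem mem_Δ {k : ℕ} {d : ℤ} :
    d ∈ Δ k ↔ d = -1 ∨ d = 1 ∨ d = (k : ℤ) - 1 ∨ d = 1 - (k : ℤ) := by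
  simp [Δ]

theorem rr_lt_rr {n : ℕ} {P : Finset (Fin n)} {x y : Fin n} (hy : y ∈ P) (h : x < y) :
    rr P x < rr P y := by
  unfold rr
  have : #{z ∈ P | z ≤ x} < #{z ∈ P | z ≤ y} := by
    apply Finset.card_lt_card
    rw [Finset.ssubset_iff_of_subset]
    · exact ⟨y, by simp [hy], by simp [h]⟩
    · intro z hz
      rw [mem_filter] at hz ⊢
      exact ⟨hz.1, hz.2.trans h.le⟩
  exact_mod_cast this

theorem rr_injOn {n : ℕ} (P : Finset (Fin n)) : Set.InjOn (rr P) P := by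
  intro x hx y hy h
  rcases lt_trichotomy x y with hlt | heq | hlt
  · exact absurd h (rr_lt_rr hy hlt).ne
  · exact heq
  · exact absurd h (rr_lt_rr hx hlt).ne'

theorem rr_mem_Icc {n : ℕ} {P : Finset (Fin n)} {x : Fin n} (hx : x ∈ P) :
    rr P x ∈ Finset.Icc (1 : ℤ) (#P : ℤ) := by
  rw [Finset.mem_Icc]
  unfold rr
  constructor
  · have : 0 < #{z ∈ P | z ≤ x} := Finset.card_pos.mpr ⟨x, by simp [hx]⟩
    omega
  · exact_mod_cast Finset.card_filter_le _ _

theorem image_rr {n : ℕ} (P : Finset (Fin n)) :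
    P.image (rr P) = Finset.Icc (1 : ℤ) (#P : ℤ) := by
  apply Finset.eq_of_subset_of_card_le
  · intro q hq
    obtain ⟨x, hx, rfl⟩ := Finset.mem_image.mp hq
    exact rr_mem_Icc hx
  · rw [Finset.card_image_of_injOn (rr_injOn P)]
    simp

theorem card_filter_sub_mem_Δ {k : ℕ} (hk : 3 ≤ k) {q : ℤ} (hq : q ∈ Finset.Icc (1 : ℤ) k) :
    #{p ∈ Finset.Icc (1 : ℤ) k | p - q ∈ Δ k ∨ q - p ∈ Δ k} = 2 := by
  rw [Finset.mem_Icc] at hq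
  rw [Finset.card_eq_two]
  by_cases h1 : q = 1
  · refine ⟨2, k, by omega, ?_⟩
    ext p
    simp only [mem_filter, Finset.mem_Icc, mem_Δ, mem_insert, mem_singleton]
    omega
  by_cases h2 : q = k
  · refine ⟨1, k - 1, by omega, ?_⟩
    ext p
    simp only [mem_filter, Finset.mem_Icc, mem_Δ, mem_insert, mem_singleton]
    omega
  · refine ⟨q - 1, q + 1, by omega, ?_⟩
    ext p
    simp only [mem_filter, Finset.mem_Icc, mem_Δ, mem_insert, mem_singleton]
    omega

theorem card_filter_adj {n : ℕ} {P : Finset (Fin n)} (hP : 3 ≤ #P) {s : Fin n} (hs : s ∈ P) :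
    #{t ∈ P | Adj P t s} = 2 := by
  rw [← card_filter_sub_mem_Δ hP (rr_mem_Icc hs), ← image_rr, Finset.filter_image,
    Finset.card_image_of_injOn ((rr_injOn P).mono (coe_subset.mpr (filter_subset _ _)))]
  congr 1
  ext t
  rw [mem_filter, mem_filter, Adj]
  tauto

theorem not_adj_self {n : ℕ} {P : Finset (Fin n)} (hP : 3 ≤ #P) (s : Fin n) : ¬ Adj P s s := by
  rintro ⟨-, -, h⟩
  simp only [mem_Δ] at h
  omega

theorem rr_univ {n : ℕ} (x : Fin n) : rr univ x = (x : ℤ) + 1 := by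
  unfold rr
  have : (univ.filter fun z => z ≤ x) = Finset.Iic x := by ext; simp
  rw [this, Fin.card_Iic]
  push_cast
  rfl

theorem adj_comm {n : ℕ} {P : Finset (Fin n)} {a b : Fin n} : Adj P a b ↔ Adj P b a := by
  unfold Adj
  tauto

theorem Adj.of_univ {n : ℕ} {P : Finset (Fin n)} {a b : Fin n} (ha : a ∈ P) (hb : b ∈ P)
    (hab : a ≠ b) (h : Adj univ a b) : Adj P a b := by
  wlog hlt : a < b generalizing a b
  · exact adj_comm.mp (this hb ha hab.symm (adj_comm.mp h) (lt_of_le_of_ne (not_lt.mp hlt) hab.symm))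
  refine ⟨ha, hb, Or.inr ?_⟩
  have h' := h.2.2
  simp only [mem_Δ, rr_univ, card_univ, Fintype.card_fin] at h'
  rw [mem_Δ]
  have hlt' : (a : ℕ) < b := hlt
  have hbn := b.isLt
  by_cases h1 : (b : ℕ) = a + 1
  · right; left
    have : P.filter (fun z => z ≤ b) = insert b (P.filter fun z => z ≤ a) := by
      ext z
      simp only [mem_filter, mem_insert, Fin.le_def, Fin.ext_iff]
      constructor
      · rintro ⟨hz, hzb⟩
        by_cases hzb' : (z : ℕ) = b
        · exact Or.inl hzb'
        · exact Or.inr ⟨hz, by omega⟩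
      · rintro (hz | ⟨hz, hza⟩)
        · rw [Fin.ext hz]; exact ⟨hb, le_rfl⟩
        · exact ⟨hz, by omega⟩
    unfold rr
    rw [this, Finset.card_insert_of_notMem (by simp [hlt])]
    push_cast; ring
  · have ha0 : (a : ℕ) = 0 := by omega
    have hbl : (b : ℕ) = n - 1 := by omega
    right; right; left
    have e1 : P.filter (fun z => z ≤ b) = P := by
      apply Finset.filter_true_of_mem
      intro z _
      rw [Fin.le_def]; omega
    have e2 : P.filter (fun z => z ≤ a) = {a} := by
      ext z
      simp only [mem_filter, mem_singleton, Fin.le_def, Fin.ext_iff]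
      constructor
      · rintro ⟨_, hz⟩; omega
      · intro hz
        rw [Fin.ext hz]; exact ⟨ha, le_rfl⟩
    unfold rr
    rw [e1, e2]; simp

theorem mem_Ω {n : ℕ} {x : Fin n → Fin n} : x ∈ Ω n ↔ Function.Injective x := by
  simp [Ω]

theorem card_Ω (n : ℕ) : #(Ω n) = n.factorial := by
  have : Fintype.card {f : Fin n → Fin n // Function.Injective f} = n.factorial := by
    rw [Fintype.card_congr (Equiv.subtypeInjectiveEquivEmbedding _ _), Fintype.card_embedding_eq]
    simp [Nat.descFactorial_self]
  rw [← this, Fintype.card_subtype]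
  rfl

theorem get_eq {m : ℕ} (x : Fin (m + 1) → Fin (m + 1)) {i : ℕ} (hi : i - 1 < m + 1) :
    get x i = x ⟨i - 1, hi⟩ := by
  unfold get
  congr 1
  exact Fin.ext (Nat.mod_eq_of_lt hi)

theorem card_filter_val_lt {n i : ℕ} (hi : i ≤ n) :
    #(univ.filter fun j : Fin n => (j : ℕ) < i) = i := by
  simp [Fin.card_filter_val_lt, hi]

theorem card_pre {n : ℕ} {x : Fin n → Fin n} (hx : Function.Injective x) {i : ℕ} (hi : i ≤ n) :
    #(pre x i) = i := by
  unfold pre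
  rw [Finset.card_image_of_injective _ hx, card_filter_val_lt hi]

theorem mem_pre {n : ℕ} (x : Fin n → Fin n) {i : ℕ} {j : Fin n} (hj : (j : ℕ) < i) :
    x j ∈ pre x i :=
  Finset.mem_image_of_mem _ (by simp [hj])

theorem get_comp_swap {m : ℕ} (y : Fin (m + 1) → Fin (m + 1)) {a b : Fin (m + 1)} {l : ℕ}
    (hl : l - 1 < m + 1) (ha : (a : ℕ) ≠ l - 1) (hb : (b : ℕ) ≠ l - 1) :
    get (y ∘ Equiv.swap a b) l = get y l := by
  rw [get_eq _ hl, get_eq _ hl, Function.comp_apply, Equiv.swap_apply_of_ne_of_ne]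
  · exact fun h => ha (by rw [← h])
  · exact fun h => hb (by rw [← h])

theorem pre_comp_swap_subset {n : ℕ} (y : Fin n → Fin n) {a b : Fin n} {l : ℕ}
    (ha : (a : ℕ) < l) (hb : (b : ℕ) < l) : pre (y ∘ Equiv.swap a b) l ⊆ pre y l := by
  intro t ht
  obtain ⟨j, hj, rfl⟩ := Finset.mem_image.mp ht
  have hj : (j : ℕ) < l := by simpa using hj
  refine mem_pre y ?_
  rw [Equiv.swap_apply_def]
  split_ifs <;> assumption

theorem comp_swap_comp_swap {n : ℕ} (y : Fin n → Fin n) (a b : Fin n) :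
    (y ∘ Equiv.swap a b) ∘ Equiv.swap a b = y := by
  funext j
  simp

theorem pre_comp_swap {n : ℕ} (y : Fin n → Fin n) {a b : Fin n} {l : ℕ}
    (ha : (a : ℕ) < l) (hb : (b : ℕ) < l) : pre (y ∘ Equiv.swap a b) l = pre y l := by
  refine (pre_comp_swap_subset y ha hb).antisymm ?_
  have := pre_comp_swap_subset (y ∘ Equiv.swap a b) ha hb
  rwa [comp_swap_comp_swap] at this

theorem mem_Lam {m r k : ℕ} {x : Fin (m + 1) → Fin (m + 1)} :
    x ∈ Lam (m + 1) r k ↔ Function.Injective x ∧ Adj univ (get x k) (get x (k + 1)) ∧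
      ∀ i, i ≤ k → r ≤ i → ¬ Adj (pre x i) (get x (i - 1)) (get x i) := by
  rw [← mem_Ω]
  exact Finset.mem_filter

/-- With no non-adjacency condition left, `Λ_n(k+1,k)` consists of the sequences whose
`k`-th and `(k+1)`-st entries are cyclically adjacent. -/
theorem card_Lam_succ_self {m k : ℕ} (hm : 2 ≤ m) (hk : 1 ≤ k) (hkm : k ≤ m) :
    #(Lam (m + 1) (k + 1) k) * m = (m + 1).factorial * 2 := by
  have e : Lam (m + 1) (k + 1) k =
      (Ω (m + 1)).filter fun x => Adj univ (get x k) (get x (k + 1)) := by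
    ext x
    rw [mem_Lam, mem_filter, mem_Ω]
    constructor
    · rintro ⟨h1, h2, -⟩; exact ⟨h1, h2⟩
    · rintro ⟨h1, h2⟩
      exact ⟨h1, h2, fun i hi hi' => by omega⟩
  let a : Fin (m + 1) := ⟨k - 1, by omega⟩
  let b : Fin (m + 1) := ⟨k, by omega⟩
  have hI : #((univ : Finset (Fin (m + 1))).erase b) = m := by simp
  have key := card_filter_mul_card_eq (Ω (m + 1)) (univ.erase b)
    (fun i y => y ∘ Equiv.swap a i) (fun i _ y => comp_swap_comp_swap y a i)
    (fun i _ y hy => mem_Ω.mpr ((mem_Ω.mp hy).comp (Equiv.injective _)))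
    (fun x => Adj univ (get x k) (get x (k + 1))) 2 ?_
  · rwa [hI, card_Ω, ← e] at key
  · intro y hy
    rw [mem_Ω] at hy
    rw [← card_filter_adj (P := univ) (by simpa using hm) (mem_univ (y b)),
      ← Finset.card_image_of_injective _ hy]
    congr 1
    have hg : ∀ i, i ≠ b → (Adj univ (get (y ∘ Equiv.swap a i) k) (get (y ∘ Equiv.swap a i) (k + 1))
        ↔ Adj univ (y i) (y b)) := by
      intro i hi
      have hib : (i : ℕ) ≠ k := fun h => hi (Fin.ext h)
      rw [get_comp_swap y (l := k + 1) (by omega) (by simp only [a]; omega) (by omega),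
        get_eq _ (i := k) (by omega), get_eq _ (i := k + 1) (by omega), Function.comp_apply]
      have : Equiv.swap a i ⟨k - 1, by omega⟩ = i := Equiv.swap_apply_left a i
      rw [this]
      rfl
    have hbij : Function.Surjective y := Finite.surjective_of_injective hy
    ext t
    obtain ⟨i, rfl⟩ := hbij t
    rw [Finset.mem_image]
    constructor
    · rintro ⟨j, hj, hji⟩
      rw [hy hji, mem_filter, mem_erase] at hj
      rw [mem_filter]
      exact ⟨mem_univ _, (hg i hj.1.1).mp hj.2⟩
    · intro h
      rw [mem_filter] at h
      have hib : i ≠ b := by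
        rintro rfl
        exact not_adj_self (by simpa using hm) _ h.2
      exact ⟨i, by rw [mem_filter, mem_erase]; exact ⟨⟨hib, mem_univ _⟩, (hg i hib).mpr h.2⟩, rfl⟩

theorem Lam_eq_filter {m j k : ℕ} (hjk : j ≤ k) :
    Lam (m + 1) j k = (Lam (m + 1) (j + 1) k).filter
      fun x => ¬ Adj (pre x j) (get x (j - 1)) (get x j) := by
  ext x
  rw [mem_filter, mem_Lam, mem_Lam]
  constructor
  · rintro ⟨h1, h2, h3⟩
    exact ⟨⟨h1, h2, fun i hi hi' => h3 i hi (by omega)⟩, h3 j hjk le_rfl⟩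
  · rintro ⟨⟨h1, h2, h3⟩, h4⟩
    refine ⟨h1, h2, fun i hi hi' => ?_⟩
    rcases hi'.eq_or_lt with rfl | hlt
    · exact h4
    · exact h3 i hi hlt

theorem comp_swap_mem_Lam {m j k : ℕ} (hj : 1 ≤ j) (hjk : j ≤ k) (hkm : k ≤ m)
    {a b : Fin (m + 1)} (ha : (a : ℕ) < j - 1) (hb : (b : ℕ) < j - 1)
    {y : Fin (m + 1) → Fin (m + 1)} (hy : y ∈ Lam (m + 1) (j + 1) k) :
    y ∘ Equiv.swap a b ∈ Lam (m + 1) (j + 1) k := by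
  rw [mem_Lam] at hy ⊢
  obtain ⟨h1, h2, h3⟩ := hy
  refine ⟨h1.comp (Equiv.injective _), ?_, fun i hi hi' => ?_⟩
  · rwa [get_comp_swap y (by omega) (by omega) (by omega),
      get_comp_swap y (by omega) (by omega) (by omega)]
  · rw [get_comp_swap y (by omega) (by omega) (by omega),
      get_comp_swap y (by omega) (by omega) (by omega), pre_comp_swap y (by omega) (by omega)]
    exact h3 i hi hi'

theorem card_filter_adj_pre {n j : ℕ} (hj : 3 ≤ j) (hjn : j ≤ n) {y : Fin n → Fin n}
    (hy : Function.Injective y) {b : Fin n} (hb : (b : ℕ) = j - 1) :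
    #{i ∈ univ.filter (fun i : Fin n => (i : ℕ) < j - 1) | Adj (pre y j) (y i) (y b)} = 2 := by
  have hc : 3 ≤ #(pre y j) := by rw [card_pre hy hjn]; exact hj
  rw [← card_filter_adj hc (mem_pre y (i := j) (j := b) (by omega)),
    ← Finset.card_image_of_injective _ hy]
  congr 1
  ext t
  rw [Finset.mem_image, mem_filter]
  constructor
  · rintro ⟨i, hi, rfl⟩
    rw [mem_filter] at hi
    exact ⟨hi.2.1, hi.2⟩
  · rintro ⟨ht, hadj⟩
    obtain ⟨i, hi, rfl⟩ := Finset.mem_image.mp ht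
    have hi : (i : ℕ) < j := by simpa using hi
    have hib : (i : ℕ) ≠ b := by
      intro h
      rw [Fin.ext h] at hadj
      exact not_adj_self hc _ hadj
    refine ⟨i, ?_, rfl⟩
    rw [mem_filter, mem_filter]
    exact ⟨⟨mem_univ _, by omega⟩, hadj⟩

theorem card_Lam_step {m j k : ℕ} (hj : 3 ≤ j) (hjk : j ≤ k) (hkm : k ≤ m) :
    #(Lam (m + 1) j k) * (j - 1) = #(Lam (m + 1) (j + 1) k) * (j - 3) := by
  let a : Fin (m + 1) := ⟨j - 2, by omega⟩
  let b : Fin (m + 1) := ⟨j - 1, by omega⟩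
  have ha : (a : ℕ) < j - 1 := by simp only [a]; omega
  have hI : #(univ.filter fun i : Fin (m + 1) => (i : ℕ) < j - 1) = j - 1 :=
    card_filter_val_lt (by omega)
  have key := card_filter_mul_card_eq (Lam (m + 1) (j + 1) k)
    (univ.filter fun i : Fin (m + 1) => (i : ℕ) < j - 1)
    (fun i y => y ∘ Equiv.swap a i) (fun i _ y => comp_swap_comp_swap y a i)
    (fun i hi y hy => comp_swap_mem_Lam (by omega) hjk hkm ha (by simpa using hi) hy)
    (fun x => ¬ Adj (pre x j) (get x (j - 1)) (get x j)) (j - 3) ?_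
  · rwa [hI, ← Lam_eq_filter hjk] at key
  · intro y hy
    have hyi := (mem_Lam.mp hy).1
    have h2 := card_filter_adj_pre hj (by omega) hyi (b := b) rfl
    have h3 := Finset.card_filter_add_card_filter_not
      (s := univ.filter fun i : Fin (m + 1) => (i : ℕ) < j - 1)
      (fun i => Adj (pre y j) (y i) (y b))
    rw [h2, hI] at h3
    have h4 : #{i ∈ univ.filter (fun i : Fin (m + 1) => (i : ℕ) < j - 1) |
        ¬ Adj (pre (y ∘ Equiv.swap a i) j) (get (y ∘ Equiv.swap a i) (j - 1))
          (get (y ∘ Equiv.swap a i) j)} =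
        #{i ∈ univ.filter (fun i : Fin (m + 1) => (i : ℕ) < j - 1) |
          ¬ Adj (pre y j) (y i) (y b)} := by
      congr 1
      apply Finset.filter_congr
      intro i hi
      have hi : (i : ℕ) < j - 1 := by simpa using hi
      have hsw : Equiv.swap a i ⟨j - 1 - 1, by omega⟩ = i := Equiv.swap_apply_left a i
      rw [pre_comp_swap y (by omega) (by omega),
        get_comp_swap y (l := j) (by omega) (by omega) (by omega),
        get_eq _ (i := j - 1) (by omega), get_eq _ (i := j) (by omega), Function.comp_apply, hsw]
    rw [h4]
    omega

theorem card_Lam {m r k : ℕ} (hr : 3 ≤ r) (hrk : r ≤ k + 1) (hk : 3 ≤ k) (hkm : k ≤ m) :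
    (#(Lam (m + 1) r k) : ℝ) / (m + 1).factorial =
      2 * (r - 2) * (r - 3) / (m * ((k - 1) * (k - 2))) := by
  have hkR : (3 : ℝ) ≤ k := by exact_mod_cast hk
  have hmR : (3 : ℝ) ≤ m := by exact_mod_cast hk.trans hkm
  have hf : ((m + 1).factorial : ℝ) ≠ 0 := by exact_mod_cast (m + 1).factorial_ne_zero
  have hk1 : (k : ℝ) - 1 ≠ 0 := by linarith
  have hk2 : (k : ℝ) - 2 ≠ 0 := by linarith
  have hm0 : (m : ℝ) ≠ 0 := by linarith
  induction hrk using Nat.decreasingInduction with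
  | self =>
    have h : (#(Lam (m + 1) (k + 1) k) : ℝ) * m = (m + 1).factorial * 2 := by
      exact_mod_cast card_Lam_succ_self (by omega) (by omega) hkm
    rw [div_eq_div_iff hf (by positivity)]
    push_cast
    linear_combination ((k : ℝ) - 1) * (k - 2) * h
  | of_succ j hjk ih =>
    have h := card_Lam_step hr (by omega : j ≤ k) hkm
    have h : (#(Lam (m + 1) j k) : ℝ) * (j - 1) = #(Lam (m + 1) (j + 1) k) * (j - 3) := by
      have h' : ((#(Lam (m + 1) j k) * (j - 1) : ℕ) : ℝ) =
          ((#(Lam (m + 1) (j + 1) k) * (j - 3) : ℕ) : ℝ) := by rw [h]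
      rw [Nat.cast_mul, Nat.cast_mul, Nat.cast_sub (by omega), Nat.cast_sub hr] at h'
      exact_mod_cast h'
    have ih := ih (by omega)
    have hjR : (3 : ℝ) ≤ j := by exact_mod_cast hr
    have hj1 : (j : ℝ) - 1 ≠ 0 := by linarith
    rw [div_eq_div_iff hf (by positivity)] at ih ⊢
    push_cast at ih
    apply mul_left_cancel₀ hj1
    linear_combination (m : ℝ) * ((k - 1) * (k - 2)) * h + ((j : ℝ) - 3) * ih

theorem pairwiseDisjoint_Lam {m r : ℕ} (hr : 1 ≤ r) :
    (↑(Finset.Icc r m) : Set ℕ).PairwiseDisjoint (Lam (m + 1) r) := by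
  have key : ∀ k l : ℕ, r ≤ k → k < l → l ≤ m → Disjoint (Lam (m + 1) r k) (Lam (m + 1) r l) := by
    intro k l hk hkl hl
    rw [Finset.disjoint_left]
    intro x hx hx'
    rw [mem_Lam] at hx hx'
    refine hx'.2.2 (k + 1) hkl (by omega) ?_
    rw [Nat.add_sub_cancel]
    refine Adj.of_univ ?_ ?_ ?_ hx.2.1
    · rw [get_eq x (by omega)]
      exact mem_pre x (by simp only; omega)
    · rw [get_eq x (by omega)]
      exact mem_pre x (by simp only; omega)
    · rw [get_eq x (by omega), get_eq x (by omega)]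
      intro h
      have := Fin.val_eq_of_eq (hx.1 h)
      simp only at this
      omega
  intro k hk l hl hne
  rw [mem_coe, Finset.mem_Icc] at hk hl
  rcases lt_or_gt_of_ne hne with h | h
  · exact key k l hk.1 h hl.2
  · exact (key l k hl.1 h hk.2).symm

theorem sum_Icc_one_div_mul {r m : ℕ} (hr : 3 ≤ r) (hrm : r ≤ m) :
    ∑ k ∈ Finset.Icc r m, 1 / (((k : ℝ) - 1) * (k - 2)) = 1 / ((r : ℝ) - 2) - 1 / ((m : ℝ) - 1) := by
  have hrR : (3 : ℝ) ≤ r := by exact_mod_cast hr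
  induction m, hrm using Nat.le_induction with
  | base =>
    have h1 : (r : ℝ) - 1 ≠ 0 := by linarith
    have h2 : (r : ℝ) - 2 ≠ 0 := by linarith
    rw [Finset.Icc_self, sum_singleton]
    field_simp
    ring
  | succ m hm ih =>
    have hmR : (r : ℝ) ≤ m := by exact_mod_cast hm
    have h1 : (m : ℝ) ≠ 0 := by linarith
    have h2 : (m : ℝ) - 1 ≠ 0 := by linarith
    rw [← Finset.insert_Icc_right_eq_Icc_add_one (by omega), sum_insert (by simp), ih]
    push_cast
    have e1 : (m : ℝ) + 1 - 1 = m := by ring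
    have e2 : (m : ℝ) + 1 - 2 = m - 1 := by ring
    rw [e1, e2]
    field_simp
    ring

theorem card_LamU {n r : ℕ} (hr : 3 ≤ r) (hrn : r < n) :
    (#(LamU n r) : ℝ) / n.factorial = 2 * (r - 3) * (n - r) / ((n - 1) * (n - 2)) := by
  obtain ⟨m, rfl⟩ : ∃ m, n = m + 1 := ⟨n - 1, by omega⟩
  have hrR : (3 : ℝ) ≤ r := by exact_mod_cast hr
  have hmR : (r : ℝ) ≤ m := by exact_mod_cast Nat.lt_succ_iff.mp hrn
  have h1 : (r : ℝ) - 2 ≠ 0 := by linarith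
  have h2 : (m : ℝ) ≠ 0 := by linarith
  have h3 : (m : ℝ) - 1 ≠ 0 := by linarith
  unfold LamU
  rw [Nat.add_sub_cancel, Finset.card_biUnion (pairwiseDisjoint_Lam (by omega)), Nat.cast_sum,
    Finset.sum_div]
  have : ∀ k ∈ Finset.Icc r m, (#(Lam (m + 1) r k) : ℝ) / (m + 1).factorial =
      2 * (r - 2) * (r - 3) / m * (1 / (((k : ℝ) - 1) * (k - 2))) := by
    intro k hk
    rw [Finset.mem_Icc] at hk
    rw [card_Lam hr (by omega) (by omega) hk.2, div_mul_div_comm, mul_one]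
  rw [Finset.sum_congr rfl this, ← Finset.mul_sum, sum_Icc_one_div_mul hr (by omega)]
  push_cast
  have e1 : (m : ℝ) + 1 - 1 = m := by ring
  have e2 : (m : ℝ) + 1 - 2 = m - 1 := by ring
  rw [e1, e2]
  field_simp
  ring

theorem tendsto_card_LamU {α : ℝ} (h0 : 0 < α) (h1 : α < 1) :
    Filter.Tendsto (fun n : ℕ => ((LamU n ⌊α * n⌋₊).card : ℝ) / (Nat.factorial n : ℝ))
      Filter.atTop (nhds (2 * α * (1 - α))) := by
  have hfloor : Filter.Tendsto (fun n : ℕ => (⌊α * n⌋₊ : ℝ) / n) Filter.atTop (nhds α) :=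
    (tendsto_nat_floor_mul_div_atTop h0.le).comp tendsto_natCast_atTop_atTop
  have hinv : Filter.Tendsto (fun n : ℕ => 1 / (n : ℝ)) Filter.atTop (nhds 0) :=
    tendsto_one_div_atTop_nhds_zero_nat
  have hlim : Filter.Tendsto (fun n : ℕ =>
      2 * ((⌊α * n⌋₊ : ℝ) / n - 3 * (1 / n)) * (1 - (⌊α * n⌋₊ : ℝ) / n) /
        ((1 - 1 / (n : ℝ)) * (1 - 2 * (1 / (n : ℝ))))) Filter.atTop
      (nhds (2 * (α - 3 * 0) * (1 - α) / ((1 - 0) * (1 - 2 * 0)))) := by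
    refine Filter.Tendsto.div ?_ ?_ (by norm_num)
    · exact ((hfloor.sub (hinv.const_mul 3)).const_mul 2).mul (hfloor.const_sub 1)
    · exact (hinv.const_sub 1).mul ((hinv.const_mul 2).const_sub 1)
  have hval : 2 * (α - 3 * 0) * (1 - α) / ((1 - 0) * (1 - 2 * 0)) = 2 * α * (1 - α) := by
    norm_num
  rw [hval] at hlim
  refine hlim.congr' ?_
  have hev : ∀ᶠ n : ℕ in Filter.atTop, 3 / α ≤ (n : ℝ) :=
    tendsto_natCast_atTop_atTop.eventually_ge_atTop _
  filter_upwards [hev] with n hn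
  have hn3 : 3 ≤ α * n := by rwa [div_le_iff₀' h0] at hn
  have hr : 3 ≤ ⌊α * n⌋₊ := Nat.le_floor (by exact_mod_cast hn3)
  have hnpos : (3 : ℝ) < n := by nlinarith
  have hrn : ⌊α * n⌋₊ < n := by
    rw [Nat.floor_lt (by linarith)]
    nlinarith
  rw [card_LamU hr hrn]
  have hn0 : (n : ℝ) ≠ 0 := by linarith
  have hn1 : (n : ℝ) - 1 ≠ 0 := by linarith
  have hn2 : (n : ℝ) - 2 ≠ 0 := by linarith
  field_simp

/-- for real `0 < α < 1`,
`lim_{n→∞} |Λ_n(⌊αn⌋)| / n! ≤ lim_{n→∞} |Λ_n(⌊n/2⌋)| / n! = 1/2`. -/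
theorem statement9 (α : ℝ) (h0 : 0 < α) (h1 : α < 1) :
    ∃ L : ℝ,
      Filter.Tendsto (fun n : ℕ =>
          ((LamU n ⌊α * n⌋₊).card : ℝ) / (Nat.factorial n : ℝ))
        Filter.atTop (nhds L) ∧
      Filter.Tendsto (fun n : ℕ =>
          ((LamU n ⌊(1 / 2 : ℝ) * n⌋₊).card : ℝ) / (Nat.factorial n : ℝ))
        Filter.atTop (nhds (1 / 2)) ∧
      L ≤ 1 / 2 := by
  refine ⟨2 * α * (1 - α), tendsto_card_LamU h0 h1, ?_, ?_⟩
  · have h := tendsto_card_LamU (α := 1 / 2) (by norm_num) (by norm_num)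
    have e : (2 : ℝ) * (1 / 2) * (1 - 1 / 2) = 1 / 2 := by norm_num
    rwa [e] at h
  · nlinarith [sq_nonneg (2 * α - 1)]
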